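/- Let μ > 0, let j ≥ 1 be an integer, and let f(x) = (1/√(2π))e^{−(x−μ)²/2} be the Gaussian density with mean μ and unit variance. Then the function q_j : (0, ∞) → ℝ defined by q_j(d) = ∫_{(−∞,0]^j} f(x_1)⋯f(x_j) · Φ(−(x_1 + ⋯ + x_j)/√d − √d·μ) dx_1⋯dx_j is strictly decreasing in the real variable d > 0. -/

import Mathlib

open MeasureTheory Real

/-- The standard normal (unit Gaussian) cumulative distribution function. -/
noncomputable def Phi (x : ℝ) : ℝ :=
  ∫ t in Set.Iic x, Real.exp (-t ^ 2 / 2) / Real.sqrt (2 * Real.pi)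

theorem integrable_exp_neg_sub_sq_div (μ : ℝ) :
    Integrable fun t : ℝ => Real.exp (-(t - μ) ^ 2 / 2) / Real.sqrt (2 * Real.pi) := by
  have h := ((integrable_exp_neg_mul_sq (b := 1 / 2) (by norm_num)).comp_sub_right μ).div_const
    (Real.sqrt (2 * Real.pi))
  refine h.congr (Filter.Eventually.of_forall fun t => ?_)
  simp only
  congr 2
  ring

theorem integrable_exp_neg_sq_div :
    Integrable fun t : ℝ => Real.exp (-t ^ 2 / 2) / Real.sqrt (2 * Real.pi) := by
  simpa using integrable_exp_neg_sub_sq_div 0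

theorem Phi_strictMono : StrictMono Phi := by
  intro a b hab
  have hd := intervalIntegral.integral_Iic_sub_Iic (a := a) (b := b)
    integrable_exp_neg_sq_div.integrableOn integrable_exp_neg_sq_div.integrableOn
  have hp := intervalIntegral.intervalIntegral_pos_of_pos
    (integrable_exp_neg_sq_div.intervalIntegrable (a := a) (b := b))
    (fun t => by positivity) hab
  unfold Phi
  linarith

theorem Phi_nonneg (x : ℝ) : 0 ≤ Phi x :=
  integral_nonneg fun t => by positivity

theorem Phi_le_integral (x : ℝ) :
    Phi x ≤ ∫ t : ℝ, Real.exp (-t ^ 2 / 2) / Real.sqrt (2 * Real.pi) :=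
  setIntegral_le_integral integrable_exp_neg_sq_div
    (Filter.Eventually.of_forall fun t => by positivity)

theorem integrable_prod_mul_Phi (j : ℕ) (μ d : ℝ) :
    Integrable fun x : Fin j → ℝ =>
      (∏ i, Real.exp (-(x i - μ) ^ 2 / 2) / Real.sqrt (2 * Real.pi))
        * Phi (-(∑ i, x i) / Real.sqrt d - Real.sqrt d * μ) := by
  refine (Integrable.fintype_prod fun _ : Fin j => integrable_exp_neg_sub_sq_div μ).mul_bdd
    (c := ∫ t : ℝ, Real.exp (-t ^ 2 / 2) / Real.sqrt (2 * Real.pi)) ?_ ?_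
  · exact (Phi_strictMono.monotone.measurable.comp (by fun_prop)).aestronglyMeasurable
  · refine Filter.Eventually.of_forall fun x => ?_
    rw [Real.norm_of_nonneg (Phi_nonneg _)]
    exact Phi_le_integral _

/-- For `μ > 0` and `j ≥ 1`, the function
`q_j(d) = ∫_{(−∞,0]^j} f(x₁)⋯f(x_j) Φ(−(x₁+⋯+x_j)/√d − √d·μ) dx₁⋯dx_j`,
with `f` the Gaussian density of mean `μ` and unit variance, is strictly decreasing
on `(0, ∞)`. -/
theorem qj_strictAntiOn
    (j : ℕ) (hj : 1 ≤ j) (μ : ℝ) (hμ : 0 < μ) :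
    StrictAntiOn (fun d : ℝ =>
      ∫ x in Set.univ.pi fun _ : Fin j => Set.Iic (0 : ℝ),
        (∏ i, Real.exp (-(x i - μ) ^ 2 / 2) / Real.sqrt (2 * Real.pi))
          * Phi (-(∑ i, x i) / Real.sqrt d - Real.sqrt d * μ))
      (Set.Ioi 0) := by
  intro a ha₀ b _ hab
  have ha' : 0 < √a := Real.sqrt_pos.2 ha₀
  have hab' : √a < √b := Real.sqrt_lt_sqrt (le_of_lt ha₀) hab
  have hs : MeasurableSet (Set.univ.pi fun _ : Fin j => Set.Iic (0 : ℝ)) :=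
    MeasurableSet.univ_pi fun _ => measurableSet_Iic
  have hlt : ∀ x ∈ Set.univ.pi fun _ : Fin j => Set.Iic (0 : ℝ),
      (∏ i, Real.exp (-(x i - μ) ^ 2 / 2) / Real.sqrt (2 * Real.pi))
          * Phi (-(∑ i, x i) / Real.sqrt b - Real.sqrt b * μ) <
      (∏ i, Real.exp (-(x i - μ) ^ 2 / 2) / Real.sqrt (2 * Real.pi))
          * Phi (-(∑ i, x i) / Real.sqrt a - Real.sqrt a * μ) := by
    intro x hx
    have hsum : 0 ≤ -∑ i, x i :=
      neg_nonneg.2 (Finset.sum_nonpos fun i _ => hx i (Set.mem_univ i))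
    refine mul_lt_mul_of_pos_left (Phi_strictMono ?_)
      (Finset.prod_pos fun i _ => by positivity)
    have h₁ := div_le_div_of_nonneg_left hsum ha' hab'.le
    have h₂ := mul_lt_mul_of_pos_right hab' hμ
    linarith
  have hle := ae_restrict_of_forall_mem (μ := volume) hs fun x hx => (hlt x hx).le
  have hb := (integrable_prod_mul_Phi j μ b).integrableOn
    (s := Set.univ.pi fun _ : Fin j => Set.Iic (0 : ℝ))
  have ha := (integrable_prod_mul_Phi j μ a).integrableOn
    (s := Set.univ.pi fun _ : Fin j => Set.Iic (0 : ℝ))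
  refine lt_of_le_of_ne (integral_mono_ae hb ha hle) fun heq => ?_
  have hfalse : ∀ᵐ _ ∂volume.restrict (Set.univ.pi fun _ : Fin j => Set.Iic (0 : ℝ)), False := by
    filter_upwards [(integral_eq_iff_of_ae_le hb ha hle).1 heq, ae_restrict_mem hs] with x hx hxs
    exact (hlt x hxs).ne hx
  rw [Filter.eventually_false_iff_eq_bot, ae_eq_bot, Measure.restrict_eq_zero,
    volume_pi_pi] at hfalse
  simp at hfalse
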